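/- arXiv:1908.11554 — 10 statements merged into one kernel-verified Lean document; each statement's English description precedes it below -/
import Mathlib

section
/- In a symmetric additively separable hedonic game on a finite set V of agents, every partition of V that attains the maximum social welfare over all partitions of V is Nash-stable. -/
/-- `P` assigns to each agent the coalition (block of the partition) containing it. -/
def IsPartitionFun {A : Type*} [Fintype A] [DecidableEq A] (P : A → Finset A) : Prop :=
  (∀ a, a ∈ P a) ∧ ∀ a b, b ∈ P a → P b = P a

/-- The utility of agent `a` under partition `P`: the sum of the weights `w a b`
over the other members `b` of `a`'s coalition. -/
def util {A : Type*} [Fintype A] [DecidableEq A] (w : A → A → ℚ) (P : A → Finset A) (a : A) : ℚ :=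
  ∑ b ∈ (P a).erase a, w a b

/-- The social welfare of partition `P`: the sum of the utilities of all agents. -/
def welfare {A : Type*} [Fintype A] [DecidableEq A] (w : A → A → ℚ) (P : A → Finset A) : ℚ :=
  ∑ a, util w P a

/-- A partition is Nash-stable if no agent `u` can strictly increase its utility by
moving to another existing coalition or to the empty coalition. -/
def NashStable {A : Type*} [Fintype A] [DecidableEq A] (w : A → A → ℚ) (P : A → Finset A) :
    Prop :=
  ∀ u : A, ∀ C : Finset A, (C = ∅ ∨ ∃ v, C = P v) → C ≠ P u →
    ∑ b ∈ C, w u b ≤ util w P u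

theorem IsPartitionFun.mem_comm {A : Type*} [Fintype A] [DecidableEq A] {P : A → Finset A}
    (hP : IsPartitionFun P) {a b : A} : a ∈ P b ↔ b ∈ P a :=
  ⟨fun h => hP.2 b a h ▸ hP.1 b, fun h => hP.2 a b h ▸ hP.1 a⟩

/-- For symmetric weights, the welfare splits into the welfare of the game without `u` and
twice the utility of `u`. -/
theorem welfare_eq_sum_erase_add {A : Type*} [Fintype A] [DecidableEq A] {w : A → A → ℚ}
    (hsym : ∀ a b, w a b = w b a) {P : A → Finset A} (hP : IsPartitionFun P) (u : A) :
    welfare w P =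
      ∑ a ∈ Finset.univ.erase u, ∑ b ∈ ((P a).erase u).erase a, w a b + 2 * util w P u := by
  have hutil : ∀ a ∈ Finset.univ.erase u, util w P a =
      ∑ b ∈ ((P a).erase u).erase a, w a b + if a ∈ P u then w u a else 0 := by
    intro a ha
    have hau : u ≠ a := (Finset.ne_of_mem_erase ha).symm
    rw [Finset.erase_right_comm, util]
    split_ifs with h
    · rw [hsym u a, Finset.sum_erase_add _ _ (Finset.mem_erase.2 ⟨hau, hP.mem_comm.1 h⟩)]
    · rw [Finset.erase_eq_of_notMem fun h' => h (hP.mem_comm.1 (Finset.mem_of_mem_erase h')),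
        add_zero]
  have hu : ∑ a ∈ Finset.univ.erase u, (if a ∈ P u then w u a else 0) = util w P u := by
    rw [← Finset.sum_filter, util]
    congr 1
    ext a
    simp
  rw [welfare, ← Finset.sum_erase_add _ _ (Finset.mem_univ u), Finset.sum_congr rfl hutil,
    Finset.sum_add_distrib, hu]
  ring

/-- The partition obtained from `P` when `u` leaves its coalition and joins `C`. -/
def moveTo {A : Type*} [DecidableEq A] (P : A → Finset A) (u : A) (C : Finset A) (a : A) :
    Finset A :=
  if a = u ∨ a ∈ C then insert u C else (P a).erase u

theorem IsPartitionFun.moveTo {A : Type*} [Fintype A] [DecidableEq A] {P : A → Finset A}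
    (hP : IsPartitionFun P) (u : A) {C : Finset A} (hC : ∀ a ∈ C, P a = C) :
    IsPartitionFun (moveTo P u C) := by
  refine ⟨fun a => ?_, fun a b hb => ?_⟩
  · by_cases h : a = u ∨ a ∈ C
    · simp [_root_.moveTo, h]
    · simp only [_root_.moveTo, if_neg h]
      exact Finset.mem_erase.2 ⟨fun h' => h (.inl h'), hP.1 a⟩
  · by_cases h : a = u ∨ a ∈ C
    · simp only [_root_.moveTo, if_pos h, Finset.mem_insert] at hb ⊢
      rw [if_pos hb]
    · simp only [_root_.moveTo, if_neg h, Finset.mem_erase] at hb ⊢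
      have hbC : b ∉ C := fun hbC =>
        h (.inr (hC b hbC ▸ hP.mem_comm.1 hb.2))
      rw [if_neg (not_or.2 ⟨hb.1, hbC⟩), hP.2 a b hb.2]

/-- In a symmetric additively separable hedonic game on a finite set of agents,
every partition attaining the maximum social welfare over all partitions is Nash-stable. -/
theorem max_welfare_partition_is_nash_stable {A : Type*} [Fintype A] [DecidableEq A]
    (w : A → A → ℚ) (hdiag : ∀ a, w a a = 0) (hsym : ∀ a b, w a b = w b a)
    (P : A → Finset A) (hP : IsPartitionFun P)
    (hmax : ∀ Q : A → Finset A, IsPartitionFun Q → welfare w Q ≤ welfare w P) :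
    NashStable w P := by
  intro u C hC hne
  have hblock : ∀ a ∈ C, P a = C := by
    rintro a ha
    rcases hC with rfl | ⟨v, rfl⟩
    · simp at ha
    · exact hP.2 v a ha
  have huC : u ∉ C := fun h => hne (hblock u h).symm
  have hQ := hP.moveTo u hblock
  have hrest : ∀ a ∈ Finset.univ.erase u,
      ∑ b ∈ ((moveTo P u C a).erase u).erase a, w a b =
        ∑ b ∈ ((P a).erase u).erase a, w a b := by
    intro a ha
    have hau : a ≠ u := Finset.ne_of_mem_erase ha
    by_cases h : a ∈ C
    · simp [moveTo, h, hblock a h, huC]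
    · simp [moveTo, h, hau]
  have hu : util w (moveTo P u C) u = ∑ b ∈ C, w u b := by
    simp [util, moveTo, huC]
  have hle := hmax _ hQ
  rw [welfare_eq_sum_erase_add hsym hQ u, welfare_eq_sum_erase_add hsym hP u,
    Finset.sum_congr rfl hrest, hu] at hle
  linarith
end

section
/- Let G = (V,E) be a finite simple graph with |V| = n and |E| = m, and let G′ be the associated ASHG on agent set V ∪ {s₁,s₂,s₃}. If (V₁,V₂,V₃) is a partition of V such that exactly k edges of G have their endpoints in two different sets, then the partition {V₁∪{s₁}, V₂∪{s₂}, V₃∪{s₃}} of the agents of G′ has social welfare exactly 2(3mn − m + k). -/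
/-- The weights of the ASHG `G′` associated to a finite simple graph `G` with
`n = |V|`, `m = |E|`: agents are `V ⊕ Fin 3` (the `Fin 3` part being the super
vertices `s₁, s₂, s₃`), `w(sᵢ, v) = 3m`, `w(sᵢ, sⱼ) = −6mn` for `i ≠ j`,
`w(x, y) = −1` for every edge `{x,y}` of `G`, and all other weights `0`. -/
def gw {V : Type*} [Fintype V] [DecidableEq V] (G : SimpleGraph V) [DecidableRel G.Adj] :
    V ⊕ Fin 3 → V ⊕ Fin 3 → ℚ := fun x y =>
  match x, y with
  | Sum.inl a, Sum.inl b => if G.Adj a b then -1 else 0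
  | Sum.inl _, Sum.inr _ => 3 * (G.edgeFinset.card : ℚ)
  | Sum.inr _, Sum.inl _ => 3 * (G.edgeFinset.card : ℚ)
  | Sum.inr i, Sum.inr j =>
      if i = j then 0 else -6 * (G.edgeFinset.card : ℚ) * (Fintype.card V : ℚ)

/-- The partition `{V₁ ∪ {s₁}, V₂ ∪ {s₂}, V₃ ∪ {s₃}}` of the agents of `G′` induced by a
partition `c : V → Fin 3` of the vertices of `G` into three sets. -/
def colPart {V : Type*} [Fintype V] [DecidableEq V] (c : V → Fin 3) :
    V ⊕ Fin 3 → Finset (V ⊕ Fin 3) := fun x =>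
  Finset.univ.filter (fun y => Sum.elim c id y = Sum.elim c id x)

/-- The number of edges of `G` whose endpoints lie in two different sets of the partition
of `V` given by `c : V → Fin 3`. -/
noncomputable def crossCount {V : Type*} [Fintype V] [DecidableEq V]
    (G : SimpleGraph V) [DecidableRel G.Adj] (c : V → Fin 3) : ℕ :=
  (@Finset.filter _ (fun e => ∃ x y : V, e = s(x, y) ∧ c x ≠ c y) (Classical.decPred _)
    G.edgeFinset).card

/-- The spanning subgraph of `G` whose edges have both endpoints in the same class of `c`. -/
def monoSubgraph {V ι : Type*} (G : SimpleGraph V) (c : V → ι) : SimpleGraph V where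
  Adj a b := G.Adj a b ∧ c a = c b
  symm := ⟨fun _ _ h => ⟨h.1.symm, h.2.symm⟩⟩
  loopless := ⟨fun _ h => h.1.ne rfl⟩

open Classical in
lemma card_edgeFinset_monoSubgraph_add_crossCount {V : Type*} [Fintype V]
    (G : SimpleGraph V) [DecidableRel G.Adj] (c : V → Fin 3) :
    (monoSubgraph G c).edgeFinset.card + crossCount G c = G.edgeFinset.card := by
  have h : (monoSubgraph G c).edgeFinset =
      G.edgeFinset.filter (fun e => ¬ ∃ x y : V, e = s(x, y) ∧ c x ≠ c y) := by
    ext e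
    induction e using Sym2.ind with
    | _ a b =>
      simp only [SimpleGraph.mem_edgeFinset, SimpleGraph.mem_edgeSet, Finset.mem_filter]
      refine and_congr_right fun _ => ⟨?_, fun h => ?_⟩
      · rintro hc ⟨x, y, hxy, hne⟩
        rcases Sym2.eq_iff.1 hxy with ⟨rfl, rfl⟩ | ⟨rfl, rfl⟩
        · exact hne hc
        · exact hne hc.symm
      · by_contra hc
        exact h ⟨a, b, rfl, hc⟩
  rw [h, crossCount, add_comm]
  convert Finset.card_filter_add_card_filter_not (s := G.edgeFinset)
    (fun e => ∃ x y : V, e = s(x, y) ∧ c x ≠ c y)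

lemma sum_sum_adj_eq_two_mul_card_edgeFinset {V : Type*} [Fintype V]
    (H : SimpleGraph V) [DecidableRel H.Adj] :
    ∑ a, ∑ b, (if H.Adj a b then (1 : ℚ) else 0) = 2 * (H.edgeFinset.card : ℚ) := by
  classical
  have h := H.sum_degrees_eq_twice_card_edges
  have hq : ∑ a, (H.degree a : ℚ) = 2 * (H.edgeFinset.card : ℚ) := by exact_mod_cast h
  rw [← hq]
  refine Finset.sum_congr rfl fun a _ => ?_
  rw [Finset.sum_boole, ← H.card_neighborFinset_eq_degree, H.neighborFinset_eq_filter]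

lemma gw_self {V : Type*} [Fintype V] [DecidableEq V] (G : SimpleGraph V)
    [DecidableRel G.Adj] (x : V ⊕ Fin 3) : gw G x x = 0 := by
  cases x <;> simp [gw]

lemma util_colPart_inl {V : Type*} [Fintype V] [DecidableEq V] (w : V ⊕ Fin 3 → V ⊕ Fin 3 → ℚ)
    (c : V → Fin 3) (a : V) (hw : w (.inl a) (.inl a) = 0) :
    util w (colPart c) (.inl a) =
      (∑ b, if c b = c a then w (.inl a) (.inl b) else 0) + w (.inl a) (.inr (c a)) := by
  have h : util w (colPart c) (.inl a) = (∑ b, if c b = c a then w (.inl a) (.inl b) else 0) +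
      ∑ j, if j = c a then w (.inl a) (.inr j) else 0 := by
    rw [util, Finset.sum_erase _ hw, colPart, Finset.sum_filter, Fintype.sum_sum_type]
    rfl
  rw [h, Fintype.sum_ite_eq']

lemma util_colPart_inr {V : Type*} [Fintype V] [DecidableEq V] (w : V ⊕ Fin 3 → V ⊕ Fin 3 → ℚ)
    (c : V → Fin 3) (i : Fin 3) (hw : w (.inr i) (.inr i) = 0) :
    util w (colPart c) (.inr i) = ∑ b, if c b = i then w (.inr i) (.inl b) else 0 := by
  have h : util w (colPart c) (.inr i) = (∑ b, if c b = i then w (.inr i) (.inl b) else 0) +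
      ∑ j, if j = i then w (.inr i) (.inr j) else 0 := by
    rw [util, Finset.sum_erase _ hw, colPart, Finset.sum_filter, Fintype.sum_sum_type]
    rfl
  rw [h, Fintype.sum_ite_eq', hw, add_zero]

/-- if `(V₁,V₂,V₃)` is a partition of `V` with exactly `k` crossing edges, then
the partition `{V₁∪{s₁}, V₂∪{s₂}, V₃∪{s₃}}` of the agents of `G′` has social welfare
exactly `2(3mn − m + k)`. -/
theorem welfare_of_colPart {V : Type*} [Fintype V] [DecidableEq V]
    (G : SimpleGraph V) [DecidableRel G.Adj] (c : V → Fin 3) (k : ℕ)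
    (hk : k = crossCount G c) :
    welfare (gw G) (colPart c) =
      2 * (3 * (G.edgeFinset.card : ℚ) * (Fintype.card V : ℚ)
        - (G.edgeFinset.card : ℚ) + (k : ℚ)) := by
  classical
  have hcard : ((monoSubgraph G c).edgeFinset.card : ℚ) + (k : ℚ) = G.edgeFinset.card := by
    rw [hk]
    exact_mod_cast card_edgeFinset_monoSubgraph_add_crossCount G c
  have hV : ∀ a b : V, (if c b = c a then (if G.Adj a b then (-1 : ℚ) else 0) else 0) =
      -(if (monoSubgraph G c).Adj a b then 1 else 0) := by
    intro a b
    by_cases h : G.Adj a b <;> by_cases h' : c a = c b <;>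
      simp [monoSubgraph, h, h', eq_comm (a := c b)]
  have hsum := sum_sum_adj_eq_two_mul_card_edgeFinset (monoSubgraph G c)
  have hcross : ∑ i : Fin 3, ∑ b : V, (if c b = i then 3 * (G.edgeFinset.card : ℚ) else 0) =
      Fintype.card V * (3 * (G.edgeFinset.card : ℚ)) := by
    rw [Finset.sum_comm]
    simp
  simp only [welfare, Fintype.sum_sum_type, util_colPart_inl _ _ _ (gw_self G _),
    util_colPart_inr _ _ _ (gw_self G _), gw, hV, Finset.sum_add_distrib,
    Finset.sum_neg_distrib, hsum, hcross, Finset.sum_const, Finset.card_univ, nsmul_eq_mul]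
  linear_combination (-2) * hcard
end

section
/- Let a₁,…,aₙ be positive integers with W = Σᵢ aᵢ and aᵢ < W/2 for every i, and let H be the associated ASHG. If S ⊆ {1,…,n} satisfies Σ_{i∈S} aᵢ = W/2, then the partition {{vᵢ : i ∈ S} ∪ {u₁}, {vᵢ : i ∉ S} ∪ {u₂}} of the agents of H is envy-free and has social welfare exactly 2W. -/
/-- A partition is envy-free if no agent `u` envies an agent `x` of a different coalition,
i.e. `u` cannot strictly increase its utility by taking `x`'s place. -/
def EnvyFree {A : Type*} [Fintype A] [DecidableEq A] (w : A → A → ℚ) (P : A → Finset A) :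
    Prop :=
  ∀ u x : A, P u ≠ P x → ∑ b ∈ (P x).erase x, w u b ≤ util w P u

/-- The coalition partition induced by a classification function `f`:
the coalition of `x` is the set of agents with the same `f`-value as `x`. -/
def classPart {A κ : Type*} [Fintype A] [DecidableEq A] [DecidableEq κ] (f : A → κ) :
    A → Finset A := fun x => Finset.univ.filter (fun y => f y = f x)

/-- The weights of the ASHG `H` associated to positive integers `a₁, …, aₙ` with
`W = Σᵢ aᵢ`: agents are `v₁, …, vₙ` (the `Sum.inl` part) and `u₁, u₂` (the `Sum.inr` part),
`w(vᵢ, u₁) = w(vᵢ, u₂) = aᵢ`, `w(u₁, u₂) = −2W − 1`, and all other weights `0`. -/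
def Hw {n : ℕ} (a : Fin n → ℕ) : Fin n ⊕ Fin 2 → Fin n ⊕ Fin 2 → ℚ := fun x y =>
  match x, y with
  | Sum.inl i, Sum.inr _ => (a i : ℚ)
  | Sum.inr _, Sum.inl i => (a i : ℚ)
  | Sum.inr p, Sum.inr q => if p = q then 0 else -2 * (∑ t, (a t : ℚ)) - 1
  | Sum.inl _, Sum.inl _ => 0

/-- The sum of `w u` over the coalition of `x` with `x` removed, for the two-coalition partition
induced by `S`. -/
lemma sum_erase_classPart {n : ℕ} (w : Fin n ⊕ Fin 2 → Fin n ⊕ Fin 2 → ℚ) (S : Finset (Fin n))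
    (u x : Fin n ⊕ Fin 2) :
    ∑ b ∈ (classPart (Sum.elim (fun i => decide (i ∈ S)) (fun j => decide (j = 0))) x).erase x,
        w u b =
      (if Sum.elim (fun i => decide (i ∈ S)) (fun j => decide (j = 0)) x = true then
        ∑ i ∈ S, w u (Sum.inl i) + w u (Sum.inr 0)
      else ∑ i ∈ Sᶜ, w u (Sum.inl i) + w u (Sum.inr 1)) - w u x := by
  rw [Finset.sum_erase_eq_sub (by simp [classPart])]
  congr 1
  generalize hf : Sum.elim (fun i => decide (i ∈ S)) (fun j : Fin 2 => decide (j = 0)) = f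
  unfold classPart
  rw [Finset.sum_filter, Fintype.sum_sum_type, Fin.sum_univ_two]
  generalize f x = c
  subst hf
  have hc : Sᶜ = Finset.univ.filter (· ∉ S) := by ext; simp
  cases c
  · simp [hc, Finset.sum_filter]
  · simp

/-- if `S ⊆ {1,…,n}` satisfies `Σ_{i∈S} aᵢ = W/2`, then the partition
`{{vᵢ : i ∈ S} ∪ {u₁}, {vᵢ : i ∉ S} ∪ {u₂}}` of the agents of `H` is envy-free and has
social welfare exactly `2W`. -/
theorem partition_gives_envy_free_welfare {n : ℕ} (a : Fin n → ℕ) (hpos : ∀ i, 0 < a i)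
    (W : ℚ) (hW : W = ∑ i, (a i : ℚ)) (hsmall : ∀ i, (a i : ℚ) < W / 2)
    (S : Finset (Fin n)) (hS : ∑ i ∈ S, (a i : ℚ) = W / 2) :
    EnvyFree (Hw a)
        (classPart (Sum.elim (fun i => decide (i ∈ S)) (fun j => decide (j = 0)))) ∧
      welfare (Hw a)
        (classPart (Sum.elim (fun i => decide (i ∈ S)) (fun j => decide (j = 0)))) = 2 * W := by
  have hSc : ∑ i ∈ Sᶜ, (a i : ℚ) = W / 2 := by
    have := Finset.sum_add_sum_compl S (fun i => (a i : ℚ))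
    linarith
  have hv : ∀ i, util (Hw a) (classPart (Sum.elim (fun i => decide (i ∈ S))
      (fun j => decide (j = 0)))) (Sum.inl i) = a i := by
    intro i
    rw [util, sum_erase_classPart]
    simp [Hw]
  have hu : ∀ j, util (Hw a) (classPart (Sum.elim (fun i => decide (i ∈ S))
      (fun j => decide (j = 0)))) (Sum.inr j) = W / 2 := by
    intro j
    rw [util, sum_erase_classPart]
    fin_cases j <;> simp [Hw, hS, hSc]
  refine ⟨?_, ?_⟩
  · intro u x hne
    have hf : Sum.elim (fun i => decide (i ∈ S)) (fun j : Fin 2 => decide (j = 0)) u ≠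
        Sum.elim (fun i => decide (i ∈ S)) (fun j : Fin 2 => decide (j = 0)) x := by
      intro h
      exact hne (by simp only [classPart, h])
    have hW0 : 0 ≤ W := hW ▸ Finset.sum_nonneg fun i _ => Nat.cast_nonneg _
    rw [sum_erase_classPart]
    rcases u with i | j
    · rw [hv]
      rcases x with k | k
      · simp [Hw]
      · simp [Hw]
    · rw [hu]
      rcases x with k | k
      · have hk : (0 : ℚ) ≤ a k := Nat.cast_nonneg _
        by_cases hkS : k ∈ S <;> fin_cases j <;>
          simp [Hw, hS, hSc, ← hW, hkS] at hf ⊢ <;> linarith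
      · fin_cases j <;> fin_cases k <;> simp [Hw, hS, hSc] at hf ⊢
  · rw [welfare, Fintype.sum_sum_type]
    simp only [hv, hu, ← hW, Fin.sum_univ_two]
    ring
end

section
/- Let a₁,…,aₙ be positive integers with W = Σᵢ aᵢ and aᵢ < W/2 for every i, and let H′ be the associated ASHG. If S ⊆ {1,…,n} satisfies Σ_{i∈S} aᵢ = W/2, then under the partition {{vᵢ, v′ᵢ, v″ᵢ : i ∈ S} ∪ {u₁}, {vᵢ, v′ᵢ, v″ᵢ : i ∉ S} ∪ {u₂}} of the agents of H′, every agent has utility exactly W/2. -/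
/-- The weights of the ASHG `H′` associated to positive integers `a₁, …, aₙ` with
`W = Σᵢ aᵢ`: agents are `vᵢ = (i,0)`, `v′ᵢ = (i,1)`, `v″ᵢ = (i,2)` (the `Sum.inl` part) and
`u₁, u₂` (the `Sum.inr` part); `w(vᵢ,u₁) = w(vᵢ,u₂) = aᵢ`, `w(u₁,u₂) = −2W−1`,
`w(vᵢ,v′ᵢ) = w(vᵢ,v″ᵢ) = W/4 − aᵢ/2`, `w(v′ᵢ,v″ᵢ) = W/4 + aᵢ/2`, all other weights `0`. -/
def H'w {n : ℕ} (a : Fin n → ℕ) :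
    (Fin n × Fin 3) ⊕ Fin 2 → (Fin n × Fin 3) ⊕ Fin 2 → ℚ := fun x y =>
  let W : ℚ := ∑ t, (a t : ℚ)
  match x, y with
  | Sum.inl (i, t), Sum.inl (j, r) =>
      if i = j then
        if (t = 0 ∧ (r = 1 ∨ r = 2)) ∨ ((t = 1 ∨ t = 2) ∧ r = 0) then W / 4 - (a i : ℚ) / 2
        else if (t = 1 ∧ r = 2) ∨ (t = 2 ∧ r = 1) then W / 4 + (a i : ℚ) / 2
        else 0
      else 0
  | Sum.inl (i, t), Sum.inr _ => if t = 0 then (a i : ℚ) else 0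
  | Sum.inr _, Sum.inl (i, t) => if t = 0 then (a i : ℚ) else 0
  | Sum.inr p, Sum.inr q => if p = q then 0 else -2 * W - 1

theorem util_classPart {A κ : Type*} [Fintype A] [DecidableEq A] [DecidableEq κ]
    (w : A → A → ℚ) (f : A → κ) (x : A) (hw : w x x = 0) :
    util w (classPart f) x = ∑ y, if f y = f x then w x y else 0 := by
  rw [util, Finset.sum_erase _ hw, classPart, Finset.sum_filter]

theorem H'w_self {n : ℕ} (a : Fin n → ℕ) (x : (Fin n × Fin 3) ⊕ Fin 2) : H'w a x x = 0 := by
  rcases x with ⟨i, t⟩ | p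
  · fin_cases t <;> simp [H'w]
  · simp [H'w]

/-- if `S ⊆ {1,…,n}` satisfies `Σ_{i∈S} aᵢ = W/2`, then under the partition
`{{vᵢ,v′ᵢ,v″ᵢ : i ∈ S} ∪ {u₁}, {vᵢ,v′ᵢ,v″ᵢ : i ∉ S} ∪ {u₂}}` of the agents of `H′`,
every agent has utility exactly `W/2`. -/
theorem every_agent_half_utility {n : ℕ} (a : Fin n → ℕ) (hpos : ∀ i, 0 < a i)
    (W : ℚ) (hW : W = ∑ i, (a i : ℚ)) (hsmall : ∀ i, (a i : ℚ) < W / 2)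
    (S : Finset (Fin n)) (hS : ∑ i ∈ S, (a i : ℚ) = W / 2) :
    ∀ x : (Fin n × Fin 3) ⊕ Fin 2,
      util (H'w a)
        (classPart (Sum.elim (fun p => decide (p.1 ∈ S)) (fun j => decide (j = 0)))) x
      = W / 2 := by
  intro x
  have hcompl : ∑ i, (if i ∈ S then 0 else (a i : ℚ)) = W / 2 := by
    have hsplit : ∑ i, (if i ∈ S then 0 else (a i : ℚ)) + ∑ i ∈ S, (a i : ℚ) = W := by
      rw [← Finset.sum_filter_add_sum_filter_not Finset.univ (· ∈ S)] at hW
      simp [hW, Finset.sum_ite, add_comm]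
    linarith
  rw [util_classPart _ _ _ (H'w_self a x), Fintype.sum_sum_type, Fintype.sum_prod_type]
  simp only [Fin.sum_univ_three, Fin.sum_univ_two]
  rcases x with ⟨i, t⟩ | p
  · rw [Finset.sum_eq_single i (fun j _ hj => by simp [H'w, Ne.symm hj]) (by simp)]
    by_cases hi : i ∈ S <;> fin_cases t <;> simp [H'w, hi, ← hW] <;> ring
  · fin_cases p
    · simpa [H'w] using hS
    · simpa [H'w] using hcompl
end

section
/- Let a₁,…,aₙ be positive integers with W = Σᵢ aᵢ and aᵢ < W/2 for every i, and let H′ be the associated ASHG. If H′ admits a partition under which every agent has utility at least W/2, then there exists S ⊆ {1,…,n} with Σ_{i∈S} aᵢ = W/2. -/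
theorem util_eq_sum_ite {A : Type*} [Fintype A] [DecidableEq A] (w : A → A → ℚ)
    (P : A → Finset A) (a : A) (h : w a a = 0) :
    util w P a = ∑ b, if b ∈ P a then w a b else 0 := by
  rw [util, Finset.sum_erase _ h, Finset.sum_ite_mem, Finset.univ_inter]

theorem util_H'w_inr {n : ℕ} (a : Fin n → ℕ)
    (P : (Fin n × Fin 3) ⊕ Fin 2 → Finset ((Fin n × Fin 3) ⊕ Fin 2)) (p q : Fin 2) (hpq : p ≠ q) :
    util (H'w a) P (Sum.inr p) =
      ∑ i with Sum.inl (i, 0) ∈ P (Sum.inr p), (a i : ℚ) +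
        if Sum.inr q ∈ P (Sum.inr p) then -2 * ∑ i, (a i : ℚ) - 1 else 0 := by
  rw [util_eq_sum_ite _ _ _ (by simp [H'w]), Fintype.sum_sum_type, Fintype.sum_prod_type,
    Finset.sum_filter]
  congr 1
  · simp [Fin.sum_univ_three, H'w]
  · rw [Fintype.sum_eq_single q]
    · simp [H'w, hpq]
    · intro r hr
      have : p = r := by omega
      simp [H'w, this]

/-- if `H′` admits a partition under which every agent has utility at least
`W/2`, then there exists `S ⊆ {1,…,n}` with `Σ_{i∈S} aᵢ = W/2`. -/
theorem exists_half_sum_subset_of_feasible {n : ℕ} (a : Fin n → ℕ) (hpos : ∀ i, 0 < a i)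
    (W : ℚ) (hW : W = ∑ i, (a i : ℚ)) (hsmall : ∀ i, (a i : ℚ) < W / 2)
    (P : (Fin n × Fin 3) ⊕ Fin 2 → Finset ((Fin n × Fin 3) ⊕ Fin 2))
    (hP : IsPartitionFun P) (hfeas : ∀ x, W / 2 ≤ util (H'w a) P x) :
    ∃ S : Finset (Fin n), ∑ i ∈ S, (a i : ℚ) = W / 2 := by
  have hW0 : 0 ≤ W := hW ▸ Finset.sum_nonneg fun i _ => Nat.cast_nonneg _
  have h₀ := hfeas (Sum.inr 0)
  have h₁ := hfeas (Sum.inr 1)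
  rw [util_H'w_inr a P 0 1 (by decide), ← hW] at h₀
  rw [util_H'w_inr a P 1 0 (by decide), ← hW] at h₁
  have hle (S : Finset (Fin n)) : ∑ i ∈ S, (a i : ℚ) ≤ W :=
    hW ▸ Finset.sum_le_univ_sum_of_nonneg fun i => Nat.cast_nonneg _
  have hsep₀ : Sum.inr 1 ∉ P (Sum.inr 0) := by
    intro h
    rw [if_pos h] at h₀
    linarith [hle {i | Sum.inl (i, 0) ∈ P (Sum.inr 0)}]
  have hsep₁ : Sum.inr 0 ∉ P (Sum.inr 1) := fun h =>
    hsep₀ (hP.2 _ _ h ▸ hP.1 (Sum.inr 1))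
  rw [if_neg hsep₀, add_zero] at h₀
  rw [if_neg hsep₁, add_zero] at h₁
  have hdisj : Disjoint ({i | Sum.inl (i, 0) ∈ P (Sum.inr 0)} : Finset (Fin n))
      ({i | Sum.inl (i, 0) ∈ P (Sum.inr 1)} : Finset (Fin n)) := by
    rw [Finset.disjoint_filter]
    intro i _ hi₀ hi₁
    have h := (hP.2 _ _ hi₀).symm.trans (hP.2 _ _ hi₁)
    exact hsep₀ (h ▸ hP.1 (Sum.inr 1))
  have hunion := (Finset.sum_union (f := fun i => (a i : ℚ)) hdisj).symm.trans_le (hle _)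
  exact ⟨_, le_antisymm (by linarith) h₀⟩
end

section
/- Let a₁,…,aₙ be positive integers with W = Σᵢ aᵢ and aᵢ < W/2 for every i, and let H″ be the associated ASHG. If H″ admits a partition under which every agent has utility at least W/2, then there exists S ⊆ {1,…,n} with Σ_{i∈S} aᵢ = W/2. -/
/-- The weights of the ASHG `H″` associated to positive integers `a₁, …, aₙ` with
`W = Σᵢ aᵢ`: agents are `v₁, …, vₙ` (the `Sum.inl` part) and `u₁, u₂, u₃, u₄`
(the `Sum.inr` part, indexed `0,1,2,3`); `w(vᵢ,u₁) = w(vᵢ,u₂) = aᵢ`,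
`w(vᵢ,u₃) = w(vᵢ,u₄) = W/2 − aᵢ`, `w(u₁,u₂) = −2W−1`, and all other weights `0`. -/
def H''w {n : ℕ} (a : Fin n → ℕ) : Fin n ⊕ Fin 4 → Fin n ⊕ Fin 4 → ℚ := fun x y =>
  let W : ℚ := ∑ t, (a t : ℚ)
  match x, y with
  | Sum.inl i, Sum.inr j => if j = 0 ∨ j = 1 then (a i : ℚ) else W / 2 - (a i : ℚ)
  | Sum.inr j, Sum.inl i => if j = 0 ∨ j = 1 then (a i : ℚ) else W / 2 - (a i : ℚ)
  | Sum.inr p, Sum.inr q => if (p = 0 ∧ q = 1) ∨ (p = 1 ∧ q = 0) then -2 * W - 1 else 0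
  | Sum.inl _, Sum.inl _ => 0

theorem util_H''w_inr_zero {n : ℕ} (a : Fin n → ℕ) (P : Fin n ⊕ Fin 4 → Finset (Fin n ⊕ Fin 4)) :
    util (H''w a) P (Sum.inr 0) = ∑ i with Sum.inl i ∈ P (Sum.inr 0), (a i : ℚ) +
      if Sum.inr 1 ∈ P (Sum.inr 0) then -2 * ∑ t, (a t : ℚ) - 1 else 0 := by
  rw [util, Finset.sum_erase _ (by simp [H''w]), ← Finset.univ_inter (P _), ← Finset.sum_ite_mem,
    Fintype.sum_sum_type, Fin.sum_univ_four, Finset.sum_filter]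
  simp [H''w]

theorem util_H''w_inr_one {n : ℕ} (a : Fin n → ℕ) (P : Fin n ⊕ Fin 4 → Finset (Fin n ⊕ Fin 4)) :
    util (H''w a) P (Sum.inr 1) = ∑ i with Sum.inl i ∈ P (Sum.inr 1), (a i : ℚ) +
      if Sum.inr 0 ∈ P (Sum.inr 1) then -2 * ∑ t, (a t : ℚ) - 1 else 0 := by
  rw [util, Finset.sum_erase _ (by simp [H''w]), ← Finset.univ_inter (P _), ← Finset.sum_ite_mem,
    Fintype.sum_sum_type, Fin.sum_univ_four, Finset.sum_filter]
  simp [H''w]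

/-- if `H″` admits a partition under which every agent has utility at least
`W/2`, then there exists `S ⊆ {1,…,n}` with `Σ_{i∈S} aᵢ = W/2`. -/
theorem exists_half_sum_subset_of_feasible' {n : ℕ} (a : Fin n → ℕ) (hpos : ∀ i, 0 < a i)
    (W : ℚ) (hW : W = ∑ i, (a i : ℚ)) (hsmall : ∀ i, (a i : ℚ) < W / 2)
    (P : Fin n ⊕ Fin 4 → Finset (Fin n ⊕ Fin 4))
    (hP : IsPartitionFun P) (hfeas : ∀ x, W / 2 ≤ util (H''w a) P x) :
    ∃ S : Finset (Fin n), ∑ i ∈ S, (a i : ℚ) = W / 2 := by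
  subst hW
  have hle (s : Finset (Fin n)) : ∑ i ∈ s, (a i : ℚ) ≤ ∑ i, (a i : ℚ) :=
    Finset.sum_le_univ_sum_of_nonneg fun i => Nat.cast_nonneg _
  have hnonneg : (0 : ℚ) ≤ ∑ i, (a i : ℚ) := Finset.sum_nonneg fun i _ => Nat.cast_nonneg _
  have h₁ := hfeas (Sum.inr 0)
  have h₂ := hfeas (Sum.inr 1)
  rw [util_H''w_inr_zero] at h₁
  rw [util_H''w_inr_one] at h₂
  have hsep : Sum.inr 1 ∉ P (Sum.inr 0) := fun h => by
    rw [if_pos h] at h₁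
    linarith [hle {i | Sum.inl i ∈ P (Sum.inr 0)}]
  have hsep' : Sum.inr 0 ∉ P (Sum.inr 1) := fun h =>
    hsep (hP.2 _ _ h ▸ hP.1 (Sum.inr 1))
  rw [if_neg hsep, add_zero] at h₁
  rw [if_neg hsep', add_zero] at h₂
  have hdisj : Disjoint ({i | Sum.inl i ∈ P (Sum.inr 0)} : Finset (Fin n))
      ({i | Sum.inl i ∈ P (Sum.inr 1)} : Finset (Fin n)) := by
    refine Finset.disjoint_filter.2 fun i _ h h' => hsep ?_
    rw [← hP.2 _ _ h, hP.2 _ _ h']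
    exact hP.1 _
  have hunion := hle (({i | Sum.inl i ∈ P (Sum.inr 0)} : Finset (Fin n)) ∪
    ({i | Sum.inl i ∈ P (Sum.inr 1)} : Finset (Fin n)))
  rw [Finset.sum_union hdisj] at hunion
  exact ⟨Finset.univ.filter fun i => Sum.inl i ∈ P (Sum.inr 0), by linarith⟩
end

section
/- Let m ≥ 1, let a₁,…,a_{3m} be positive integers, let B be a positive integer with Σᵢ aᵢ = mB, and let G_m be the associated ASHG. If (A₁,…,A_m) is a partition of {1,…,3m} with Σ_{i∈A_j} aᵢ = B for every j, then the partition {{vᵢ : i ∈ A_j} ∪ {u_j} : j = 1,…,m} of the agents of G_m is envy-free and has social welfare exactly 2mB. -/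
/-- The weights of the ASHG `G_m` associated to positive integers `a₁, …, a_{3m}` with
`Σᵢ aᵢ = mB`: agents are `v₁, …, v_{3m}` (the `Sum.inl` part) and `u₁, …, u_m`
(the `Sum.inr` part); `w(vᵢ,u_j) = aᵢ` for all `i, j`, `w(u_p,u_q) = −mB` for `p ≠ q`,
and all other weights `0`. -/
def Gmw {m : ℕ} (a : Fin (3 * m) → ℕ) (B : ℕ) :
    Fin (3 * m) ⊕ Fin m → Fin (3 * m) ⊕ Fin m → ℚ := fun x y =>
  match x, y with
  | Sum.inl i, Sum.inr _ => (a i : ℚ)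
  | Sum.inr _, Sum.inl i => (a i : ℚ)
  | Sum.inr p, Sum.inr q => if p = q then 0 else -(m : ℚ) * (B : ℚ)
  | Sum.inl _, Sum.inl _ => 0

theorem sum_classPart_elim_id {ι κ : Type*} [Fintype ι] [DecidableEq ι] [Fintype κ]
    [DecidableEq κ] (f : ι → κ) (g : ι ⊕ κ → ℚ) (x : ι ⊕ κ) :
    ∑ b ∈ classPart (Sum.elim f id) x, g b =
      ∑ i ∈ Finset.univ.filter (fun i => f i = Sum.elim f id x), g (Sum.inl i) +
        g (Sum.inr (Sum.elim f id x)) := by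
  simp only [classPart, Finset.sum_filter, Fintype.sum_sum_type, Sum.elim_inl, Sum.elim_inr, id_eq]
  congr 1
  exact Fintype.sum_ite_eq' _ fun k => g (Sum.inr k)

theorem sum_classPart_erase {A κ : Type*} [Fintype A] [DecidableEq A] [DecidableEq κ]
    (f : A → κ) (g : A → ℚ) (x : A) :
    ∑ b ∈ (classPart f x).erase x, g b = ∑ b ∈ classPart f x, g b - g x :=
  Finset.sum_erase_eq_sub (by simp [classPart])

theorem sum_Gmw_inl_classPart {m : ℕ} (a : Fin (3 * m) → ℕ) (B : ℕ) (f : Fin (3 * m) → Fin m)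
    (i : Fin (3 * m)) (x : Fin (3 * m) ⊕ Fin m) :
    ∑ b ∈ classPart (Sum.elim f id) x, Gmw a B (Sum.inl i) b = a i := by
  simp [sum_classPart_elim_id, Gmw]

theorem sum_Gmw_inr_classPart {m : ℕ} (a : Fin (3 * m) → ℕ) (B : ℕ) (f : Fin (3 * m) → Fin m)
    (hf : ∀ j : Fin m, ∑ i ∈ Finset.univ.filter (fun i => f i = j), a i = B)
    (p : Fin m) (x : Fin (3 * m) ⊕ Fin m) :
    ∑ b ∈ classPart (Sum.elim f id) x, Gmw a B (Sum.inr p) b =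
      B + if p = Sum.elim f id x then 0 else -(m : ℚ) * B := by
  rw [sum_classPart_elim_id]
  simp only [Gmw, ← Nat.cast_sum, hf]

theorem util_Gmw_inl {m : ℕ} (a : Fin (3 * m) → ℕ) (B : ℕ) (f : Fin (3 * m) → Fin m)
    (i : Fin (3 * m)) :
    util (Gmw a B) (classPart (Sum.elim f id)) (Sum.inl i) = a i := by
  rw [util, sum_classPart_erase, sum_Gmw_inl_classPart]
  simp [Gmw]

theorem util_Gmw_inr {m : ℕ} (a : Fin (3 * m) → ℕ) (B : ℕ) (f : Fin (3 * m) → Fin m)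
    (hf : ∀ j : Fin m, ∑ i ∈ Finset.univ.filter (fun i => f i = j), a i = B) (p : Fin m) :
    util (Gmw a B) (classPart (Sum.elim f id)) (Sum.inr p) = B := by
  rw [util, sum_classPart_erase, sum_Gmw_inr_classPart a B f hf]
  simp [Gmw]

/-- if `(A₁,…,A_m)` is a partition of `{1,…,3m}` (given by the block
assignment `f`) with `Σ_{i∈A_j} aᵢ = B` for every `j`, then the partition
`{{vᵢ : i ∈ A_j} ∪ {u_j} : j = 1,…,m}` of the agents of `G_m` is envy-free and has
social welfare exactly `2mB`. -/
theorem three_partition_gives_envy_free {m : ℕ} (hm : 1 ≤ m)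
    (a : Fin (3 * m) → ℕ) (hpos : ∀ i, 0 < a i) (B : ℕ) (hB : 0 < B)
    (hsum : ∑ i, a i = m * B)
    (f : Fin (3 * m) → Fin m)
    (hf : ∀ j : Fin m, ∑ i ∈ Finset.univ.filter (fun i => f i = j), a i = B) :
    EnvyFree (Gmw a B) (classPart (Sum.elim f id)) ∧
      welfare (Gmw a B) (classPart (Sum.elim f id)) = 2 * (m : ℚ) * (B : ℚ) := by
  refine ⟨?_, ?_⟩
  · intro u x hne
    rw [sum_classPart_erase]
    rcases u with i | p
    · rw [sum_Gmw_inl_classPart, util_Gmw_inl, sub_le_self_iff]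
      rcases x with k | q <;> simp [Gmw]
    · rw [sum_Gmw_inr_classPart a B f hf, util_Gmw_inr a B f hf]
      rcases x with k | q
      · have hmB : (0 : ℚ) ≤ m * B := by positivity
        have hk : (0 : ℚ) ≤ a k := by positivity
        simp only [Gmw]
        split_ifs <;> linarith
      · simp [Gmw]
  · simp only [welfare, Fintype.sum_sum_type, util_Gmw_inl, util_Gmw_inr a B f hf,
      ← Nat.cast_sum, hsum]
    simp
    ring
end

section
/- In a tree ASHG with self-loops, let u be a leaf with unique neighbor v, and suppose s(u) < W ≤ s(u) + w(u,v). Then the instance is feasible for threshold W if and only if the instance on the tree T − u, with the same weights and self-loop values except s′(v) = s(v) + w(v,u), is feasible for threshold W. -/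
/-- The utility of agent `x` in a tree ASHG with self-loops: the self-loop value `s x` plus
the sum of `w x y` over the neighbours `y` (w.r.t. the adjacency `Adj`) of `x` lying in
`x`'s coalition. -/
noncomputable def utilS {A : Type*} [Fintype A] [DecidableEq A] (Adj : A → A → Prop)
    (w : A → A → ℚ) (s : A → ℚ) (P : A → Finset A) (x : A) : ℚ :=
  s x + ∑ y ∈ @Finset.filter _ (fun y => Adj x y) (Classical.decPred _) ((P x).erase x), w x y

/-- Feasibility for threshold `W`: some partition gives every agent utility at least `W`. -/
noncomputable def FeasibleS {A : Type*} [Fintype A] [DecidableEq A] (Adj : A → A → Prop)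
    (w : A → A → ℚ) (s : A → ℚ) (W : ℚ) : Prop :=
  ∃ P : A → Finset A, IsPartitionFun P ∧ ∀ x, W ≤ utilS Adj w s P x

open Classical in
theorem utilS_eq_sum_ite {A : Type*} [Fintype A] [DecidableEq A] (Adj : A → A → Prop)
    (w : A → A → ℚ) (s : A → ℚ) (P : A → Finset A) (x : A) :
    utilS Adj w s P x =
      s x + ∑ y, if y ≠ x ∧ y ∈ P x ∧ Adj x y then w x y else 0 := by
  unfold utilS
  rw [← Finset.sum_filter]
  congr 1
  refine Finset.sum_congr ?_ fun _ _ => rfl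
  ext y
  simp [and_assoc]

theorem utilS_leaf {V : Type*} [Fintype V] [DecidableEq V] (G : SimpleGraph V)
    (w : V → V → ℚ) (s : V → ℚ) (P : V → Finset V) {u v : V}
    (huv : G.Adj u v) (hleaf : ∀ y, G.Adj u y → y = v) :
    utilS G.Adj w s P u = s u + if v ∈ P u then w u v else 0 := by
  classical
  rw [utilS_eq_sum_ite, Finset.sum_eq_single v]
  · simp [huv, huv.ne']
  · intro y _ hy
    exact if_neg fun h => hy (hleaf y h.2.2)
  · simp

/-- Deleting a leaf `u` which shares the coalition of its neighbour `v`, while crediting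
`w v u` to the self-loop of `v`, preserves the utilities of all other agents. -/
theorem utilS_delete_leaf {V : Type*} [Fintype V] [DecidableEq V] (G : SimpleGraph V)
    (w : V → V → ℚ) (s : V → ℚ) {u v : V}
    (huv : G.Adj u v) (hleaf : ∀ y, G.Adj u y → y = v)
    (P : V → Finset V) (Q : {x : V // x ≠ u} → Finset {x : V // x ≠ u})
    (hQ : ∀ x y, y ∈ Q x ↔ y.1 ∈ P x.1) (hu : u ∈ P v) (x : {x : V // x ≠ u}) :
    utilS (fun x y : {x : V // x ≠ u} => G.Adj x.1 y.1) (fun x y => w x.1 y.1)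
      (fun x => if x.1 = v then s v + w v u else s x.1) Q x = utilS G.Adj w s P x.1 := by
  classical
  rw [utilS_eq_sum_ite, utilS_eq_sum_ite, Fintype.sum_eq_add_sum_subtype_ne _ u]
  simp only [hQ, ne_eq, Subtype.ext_iff]
  rw [← add_assoc]
  congr 1
  obtain ⟨x, hx⟩ := x
  by_cases hxv : x = v
  · subst hxv
    simp [huv.symm, huv.ne, hu]
  · have hn : ¬ G.Adj x u := fun h => hxv (hleaf x h.symm)
    simp [hxv, hn]

/-- in a tree ASHG with self-loops, if `u` is a leaf with unique neighbour `v`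
and `s(u) < W ≤ s(u) + w(u,v)`, then the instance is feasible for threshold `W` iff the
instance on `T − u`, with the same data except `s′(v) = s(v) + w(v,u)`, is feasible for
threshold `W`. -/
theorem leaf_reduction_case_ii {V : Type*} [Fintype V] [DecidableEq V]
    (G : SimpleGraph V) (hT : G.IsTree) (hcard : 2 ≤ Fintype.card V)
    (w : V → V → ℚ) (s : V → ℚ) (W : ℚ) (u v : V)
    (huv : G.Adj u v) (hleaf : ∀ y, G.Adj u y → y = v)
    (h1 : s u < W) (h2 : W ≤ s u + w u v) :
    FeasibleS G.Adj w s W ↔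
      FeasibleS (fun x y : {x : V // x ≠ u} => G.Adj x.1 y.1)
        (fun x y => w x.1 y.1)
        (fun x => if x.1 = v then s v + w v u else s x.1) W := by
  constructor
  · rintro ⟨P, ⟨hself, hpart⟩, hP⟩
    have hv : v ∈ P u := by
      by_contra hv
      have := hP u
      rw [utilS_leaf G w s P huv hleaf, if_neg hv] at this
      linarith
    have hu : u ∈ P v := hpart u v hv ▸ hself u
    refine ⟨fun x => (P x.1).subtype (· ≠ u), ⟨fun a => by simp [hself], ?_⟩, fun x => ?_⟩
    · intro a b hb
      rw [Finset.mem_subtype] at hb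
      simp only [hpart _ _ hb]
    · rw [utilS_delete_leaf G w s huv hleaf P _ (fun _ _ => Finset.mem_subtype) hu]
      exact hP x.1
  · rintro ⟨Q, ⟨hself, hpart⟩, hQ⟩
    let f : V → {x : V // x ≠ u} := fun x => if h : x = u then ⟨v, huv.ne'⟩ else ⟨x, h⟩
    have hfu : f u = ⟨v, huv.ne'⟩ := by simp [f]
    have hf (x : {x : V // x ≠ u}) : f x.1 = x := by simp [f, x.2]
    have hfv : f v = ⟨v, huv.ne'⟩ := hf ⟨v, huv.ne'⟩
    let P : V → Finset V := fun x => Finset.univ.filter fun y => f y ∈ Q (f x)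
    have hmem (x y : V) : y ∈ P x ↔ f y ∈ Q (f x) := by simp [P]
    refine ⟨P, ⟨fun a => (hmem a a).2 (hself _), ?_⟩, fun x => ?_⟩
    · intro a b hb
      simp only [P, hpart _ _ ((hmem a b).1 hb)]
    · by_cases hx : x = u
      · subst hx
        have hv : v ∈ P x := by rw [hmem, hfu, hfv]; exact hself _
        rwa [utilS_leaf G w s P huv hleaf, if_pos hv]
      · have hu : u ∈ P v := by rw [hmem, hfu, hfv]; exact hself _
        rw [← utilS_delete_leaf G w s huv hleaf P Q
          (fun x y => by rw [hmem, hf, hf]) hu ⟨x, hx⟩]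
        exact hQ _
end

section
/- In a tree ASHG with self-loops, let u be a leaf with unique neighbor v, and suppose s(u) ≥ W and moreover s(u) + w(u,v) < W or w(v,u) ≤ 0. Then the instance is feasible for threshold W if and only if the instance on the tree T − u, with all remaining weights and self-loop values unchanged, is feasible for threshold W. -/
open Classical in
/-- The utility of an agent other than `u` splits into its utility in the instance without `u`
and the contribution of `u`. -/
theorem utilS_eq_add_utilS_subtype {V : Type*} [Fintype V] [DecidableEq V]
    (Adj : V → V → Prop) (w : V → V → ℚ) (s : V → ℚ) (u : V) (P : V → Finset V)
    (Q : {x : V // x ≠ u} → Finset {x : V // x ≠ u}) (x : {x : V // x ≠ u})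
    (hPQ : ∀ y, y ∈ Q x ↔ y.1 ∈ P x.1) :
    utilS Adj w s P x.1 =
      utilS (fun x y : {x : V // x ≠ u} => Adj x.1 y.1) (fun x y => w x.1 y.1)
        (fun x => s x.1) Q x + if u ∈ P x.1 ∧ Adj x.1 u then w x.1 u else 0 := by
  rw [utilS_eq_sum_ite, utilS_eq_sum_ite, Fintype.sum_eq_add_sum_subtype_ne _ u]
  simp only [hPQ, ne_eq, x.2.symm, not_false_eq_true, true_and, Subtype.ext_iff]
  ring

/-- in a tree ASHG with self-loops, if `u` is a leaf with unique neighbour `v`,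
`s(u) ≥ W`, and moreover `s(u) + w(u,v) < W` or `w(v,u) ≤ 0`, then the instance is feasible
for threshold `W` iff the instance on `T − u`, with all remaining weights and self-loop
values unchanged, is feasible for threshold `W`. -/
theorem leaf_reduction_case_iii {V : Type*} [Fintype V] [DecidableEq V]
    (G : SimpleGraph V) (hT : G.IsTree) (hcard : 2 ≤ Fintype.card V)
    (w : V → V → ℚ) (s : V → ℚ) (W : ℚ) (u v : V)
    (huv : G.Adj u v) (hleaf : ∀ y, G.Adj u y → y = v)
    (h1 : W ≤ s u) (h2 : s u + w u v < W ∨ w v u ≤ 0) :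
    FeasibleS G.Adj w s W ↔
      FeasibleS (fun x y : {x : V // x ≠ u} => G.Adj x.1 y.1)
        (fun x y => w x.1 y.1)
        (fun x => s x.1) W := by
  classical
  constructor
  · rintro ⟨P, ⟨hself, hblock⟩, hP⟩
    refine ⟨fun x => (P x.1).subtype (· ≠ u),
      ⟨fun a => by simpa using hself a.1, fun a b hb => ?_⟩, fun x => ?_⟩
    · simp only [hblock a.1 b.1 (by simpa using hb)]
    · have hx := hP x.1
      rw [utilS_eq_add_utilS_subtype G.Adj w s u P (fun x => (P x.1).subtype (· ≠ u)) x
        (fun y => by simp)] at hx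
      split_ifs at hx with h
      · obtain ⟨hu, hadj⟩ := h
        have hxv : x.1 = v := hleaf _ hadj.symm
        rw [hxv] at hu hx
        have hvu : v ∈ P u := hblock v u hu ▸ hself v
        have huu := hP u
        rw [utilS_eq_sum_ite, Finset.sum_eq_single v
          (fun y _ hy => if_neg fun h => hy (hleaf y h.2.2)) (by simp),
          if_pos ⟨huv.ne', hvu, huv⟩] at huu
        have hw : w v u ≤ 0 := h2.resolve_left (not_lt.mpr huu)
        linarith
      · simpa using hx
  · rintro ⟨Q, ⟨hself, hblock⟩, hQ⟩
    let P : V → Finset V := fun x =>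
      if hx : x = u then {u} else (Q ⟨x, hx⟩).map (Function.Embedding.subtype _)
    have hPu : P u = {u} := by simp [P]
    have hPne (x : {x : V // x ≠ u}) : P x.1 = (Q x).map (Function.Embedding.subtype _) := by
      simp [P, x.2]
    refine ⟨P, ⟨fun a => ?_, fun a b hb => ?_⟩, fun x => ?_⟩
    · by_cases ha : a = u
      · simp [ha, hPu]
      · rw [hPne ⟨a, ha⟩]
        exact Finset.mem_map_of_mem _ (hself ⟨a, ha⟩)
    · by_cases ha : a = u
      · subst ha
        rw [hPu, Finset.mem_singleton] at hb
        rw [hb]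
      · rw [hPne ⟨a, ha⟩, Finset.mem_map] at hb
        obtain ⟨c, hc, rfl⟩ := hb
        change P c.1 = P a
        rw [hPne c, hPne ⟨a, ha⟩, hblock _ _ hc]
    · by_cases hx : x = u
      · subst hx
        simpa [utilS, hPu] using h1
      · have hu : u ∉ P x := by
          rw [hPne ⟨x, hx⟩]
          simp
        have h := utilS_eq_add_utilS_subtype G.Adj w s u P Q ⟨x, hx⟩
          (fun y => by rw [hPne ⟨x, hx⟩]; simp [y.2])
        rw [if_neg fun h => hu h.1, add_zero] at h
        exact (hQ ⟨x, hx⟩).trans_eq h.symm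
end

section
/- Let G = (V,E,w) be a finite simple graph with integer edge weights and V = {v₁,…,vₙ}, n ≥ 1, and let G′ be the associated symmetric ASHG. Then every Nash-stable partition of the agents of G′ consists of exactly two coalitions C_A and C_B with P_A ⊆ C_A, P_B ⊆ C_B, and V ⊆ C_A ∪ C_B; in particular it has the form {C₁ ∪ P_A, C₂ ∪ P_B} for some 2-partition (C₁,C₂) of V. -/
/-- `W = Σ_{e∈E} |w_e| + 1` (each edge appears twice in the double sum, whence the `/2`). -/
def bigW {n : ℕ} (G : SimpleGraph (Fin n)) [DecidableRel G.Adj]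
    (wG : Fin n → Fin n → ℤ) : ℚ :=
  (∑ x, ∑ y, if G.Adj x y then |(wG x y : ℚ)| else 0) / 2 + 1

/-- The weights of the symmetric ASHG `G′` associated to an integer-edge-weighted graph `G`
on `V = {v₁,…,vₙ}` (with `W = Σ_{e∈E}|w_e|+1` and `M = nW+1`): agents are
`V ⊕ (P_A ⊕ P_B)` where `P_A = {p^A_1,…,p^A_{n+1}}`, `P_B = {p^B_1,…,p^B_{n+1}}`
(0-indexed by `Fin (n+1)`); `w′(x,y) = −w_{xy}` on edges of `G`,
`w′(p^A_i,p^A_{i+1}) = w′(p^B_i,p^B_{i+1}) = i(W+1)` for `1 ≤ i ≤ n`,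
`w′(p^A_i,v_i) = w′(p^B_i,v_i) = W` for `1 ≤ i ≤ n`, `w′(p^A_{n+1},p^B_{n+1}) = −3M`,
and all other weights `0`. -/
def wPrime {n : ℕ} (G : SimpleGraph (Fin n)) [DecidableRel G.Adj]
    (wG : Fin n → Fin n → ℤ) :
    Fin n ⊕ (Fin (n + 1) ⊕ Fin (n + 1)) → Fin n ⊕ (Fin (n + 1) ⊕ Fin (n + 1)) → ℚ :=
  fun p q =>
    let W : ℚ := bigW G wG
    let M : ℚ := (n : ℚ) * W + 1
    match p, q with
    | Sum.inl x, Sum.inl y => if G.Adj x y then -(wG x y : ℚ) else 0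
    | Sum.inl x, Sum.inr (Sum.inl i) => if (i : ℕ) = (x : ℕ) then W else 0
    | Sum.inl x, Sum.inr (Sum.inr i) => if (i : ℕ) = (x : ℕ) then W else 0
    | Sum.inr (Sum.inl i), Sum.inl x => if (i : ℕ) = (x : ℕ) then W else 0
    | Sum.inr (Sum.inr i), Sum.inl x => if (i : ℕ) = (x : ℕ) then W else 0
    | Sum.inr (Sum.inl i), Sum.inr (Sum.inl j) =>
        if (i : ℕ) + 1 = (j : ℕ) then ((i : ℕ) + 1 : ℚ) * (W + 1)
        else if (j : ℕ) + 1 = (i : ℕ) then ((j : ℕ) + 1 : ℚ) * (W + 1) else 0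
    | Sum.inr (Sum.inr i), Sum.inr (Sum.inr j) =>
        if (i : ℕ) + 1 = (j : ℕ) then ((i : ℕ) + 1 : ℚ) * (W + 1)
        else if (j : ℕ) + 1 = (i : ℕ) then ((j : ℕ) + 1 : ℚ) * (W + 1) else 0
    | Sum.inr (Sum.inl i), Sum.inr (Sum.inr j) =>
        if (i : ℕ) = n ∧ (j : ℕ) = n then -3 * M else 0
    | Sum.inr (Sum.inr i), Sum.inr (Sum.inl j) =>
        if (i : ℕ) = n ∧ (j : ℕ) = n then -3 * M else 0

/-- The cut weight of the 2-partition `(S, Sᶜ)` of the vertices of `G`. -/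
def cutWeight {n : ℕ} (G : SimpleGraph (Fin n)) [DecidableRel G.Adj]
    (wG : Fin n → Fin n → ℤ) (S : Finset (Fin n)) : ℚ :=
  ∑ x ∈ S, ∑ y ∈ Sᶜ, if G.Adj x y then (wG x y : ℚ) else 0

/-- `(S, Sᶜ)` is a locally optimal cut of `G` under the flip neighbourhood: moving any
single vertex to the other side does not strictly increase the cut weight. -/
def LocalOptCut {n : ℕ} (G : SimpleGraph (Fin n)) [DecidableRel G.Adj]
    (wG : Fin n → Fin n → ℤ) (S : Finset (Fin n)) : Prop :=
  ∀ v : Fin n,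
    cutWeight G wG (if v ∈ S then S.erase v else insert v S) ≤ cutWeight G wG S

/-- The partition `{C₁ ∪ P_A, C₂ ∪ P_B}` of the agents of `G′` associated to the
2-partition `(C₁, C₂) = (S, Sᶜ)` of `V`. -/
def cutPart {n : ℕ} (S : Finset (Fin n)) :
    Fin n ⊕ (Fin (n + 1) ⊕ Fin (n + 1)) → Finset (Fin n ⊕ (Fin (n + 1) ⊕ Fin (n + 1))) :=
  classPart (Sum.elim (fun x => decide (x ∈ S)) (Sum.elim (fun _ => true) (fun _ => false)))

/-- The sum of an agent's weights into a set not containing `c` is at most the sum over all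
agents except `c`, provided the weights off `c` are nonnegative. -/
theorem sum_le_sum_univ_sub {A : Type*} [Fintype A] [DecidableEq A] (f : A → ℚ) (c : A)
    (hf : ∀ b, b ≠ c → 0 ≤ f b) (C : Finset A) (hc : c ∉ C) :
    ∑ b ∈ C, f b ≤ ∑ b, f b - f c := by
  have h1 : ∑ b ∈ C, f b ≤ ∑ b ∈ Finset.univ.erase c, f b := by
    refine Finset.sum_le_sum_of_subset_of_nonneg ?_ ?_
    · intro b hb
      simp only [Finset.mem_erase, Finset.mem_univ, and_true]
      rintro rfl
      exact hc hb
    · intro b hb _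
      exact hf b (Finset.ne_of_mem_erase hb)
  have h2 := Finset.add_sum_erase Finset.univ f (Finset.mem_univ c)
  linarith

theorem util_eq_sum {A : Type*} [Fintype A] [DecidableEq A] (w : A → A → ℚ) (P : A → Finset A)
    (hP : IsPartitionFun P) (a : A) (ha : w a a = 0) : util w P a = ∑ b ∈ P a, w a b := by
  have h := Finset.add_sum_erase (P a) (w a) (hP.1 a)
  rw [ha, zero_add] at h
  exact h

theorem two_mul_row_le {ι : Type*} [Fintype ι] [DecidableEq ι] (f : ι → ι → ℚ)
    (hf : ∀ x y, 0 ≤ f x y) (hs : ∀ x y, f x y = f y x) (hd : ∀ x, f x x = 0) (x : ι) :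
    2 * ∑ y, f x y ≤ ∑ z, ∑ y, f z y := by
  rw [← Finset.add_sum_erase Finset.univ (fun z => ∑ y, f z y) (Finset.mem_univ x)]
  have h1 : ∑ z ∈ Finset.univ.erase x, f z x ≤ ∑ z ∈ Finset.univ.erase x, ∑ y, f z y :=
    Finset.sum_le_sum fun z _ =>
      Finset.single_le_sum (f := f z) (fun y _ => hf z y) (Finset.mem_univ x)
  have h2 := Finset.add_sum_erase Finset.univ (fun z => f z x) (Finset.mem_univ x)
  have h3 : ∑ z, f z x = ∑ y, f x y := Finset.sum_congr rfl fun z _ => hs z x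
  simp only [hd, zero_add] at h2
  linarith

section Reduction

variable {n : ℕ} (G : SimpleGraph (Fin n)) [DecidableRel G.Adj] (wG : Fin n → Fin n → ℤ)

theorem one_le_bigW : 1 ≤ bigW G wG := by
  have h : 0 ≤ ∑ x, ∑ y, if G.Adj x y then |(wG x y : ℚ)| else 0 :=
    Finset.sum_nonneg fun x _ => Finset.sum_nonneg fun y _ => by split_ifs <;> positivity
  unfold bigW
  linarith

theorem row_abs_le_bigW (hsymG : ∀ x y, wG x y = wG y x) (x : Fin n) :
    ∑ y, (if G.Adj x y then |(wG x y : ℚ)| else 0) ≤ bigW G wG - 1 := by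
  have h := two_mul_row_le (fun x y => if G.Adj x y then |(wG x y : ℚ)| else 0)
    (fun x y => by split_ifs <;> positivity)
    (fun x y => by simp only [G.adj_comm x y, hsymG x y]) (fun x => by simp) x
  unfold bigW
  linarith

/-- The path agent with index `i` on the side `s`, where `true` stands for `P_A` and `false`
for `P_B`. -/
def pathAgent (s : Bool) (i : Fin (n + 1)) : Fin n ⊕ (Fin (n + 1) ⊕ Fin (n + 1)) :=
  Sum.inr (if s then Sum.inl i else Sum.inr i)

theorem wPrime_self (a : Fin n ⊕ (Fin (n + 1) ⊕ Fin (n + 1))) : wPrime G wG a a = 0 := by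
  rcases a with x | i | i <;> simp [wPrime]

theorem wPrime_pathAgent_succ (s : Bool) (i : Fin n) :
    wPrime G wG (pathAgent s i.castSucc) (pathAgent s i.succ) =
      ((i : ℕ) + 1 : ℚ) * (bigW G wG + 1) := by
  cases s <;> simp [wPrime, pathAgent]

theorem wPrime_pathAgent_last :
    wPrime G wG (pathAgent true (Fin.last n)) (pathAgent false (Fin.last n)) =
      -3 * ((n : ℚ) * bigW G wG + 1) := by
  simp [wPrime, pathAgent]

theorem wPrime_pathAgent_nonneg (s : Bool) (i : Fin (n + 1))
    (b : Fin n ⊕ (Fin (n + 1) ⊕ Fin (n + 1)))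
    (hb : i ≠ Fin.last n ∨ b ≠ pathAgent (!s) (Fin.last n)) :
    0 ≤ wPrime G wG (pathAgent s i) b := by
  have hW := one_le_bigW G wG
  have hi : i = Fin.last n ↔ (i : ℕ) = n := by simp [Fin.ext_iff]
  rcases b with x | j | j <;> cases s <;>
    simp only [wPrime, pathAgent, Bool.false_eq_true, if_true, if_false, Bool.not_true,
      Bool.not_false, ne_eq, Sum.inr.injEq, Sum.inl.injEq, Fin.ext_iff, Fin.val_last] at hb ⊢ <;>
    split_ifs <;> first | positivity | tauto

theorem sum_path_row_le (i : Fin (n + 1)) :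
    ∑ j : Fin (n + 1), (if (i : ℕ) + 1 = (j : ℕ) then ((i : ℕ) + 1 : ℚ) * (bigW G wG + 1)
        else if (j : ℕ) + 1 = (i : ℕ) then ((j : ℕ) + 1 : ℚ) * (bigW G wG + 1) else 0) ≤
      (i : ℕ) * (bigW G wG + 1) +
        if (i : ℕ) = n then 0 else ((i : ℕ) + 1 : ℚ) * (bigW G wG + 1) := by
  have hW := one_le_bigW G wG
  have h : ∀ j : Fin (n + 1), (if (i : ℕ) + 1 = (j : ℕ) then
        ((i : ℕ) + 1 : ℚ) * (bigW G wG + 1)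
        else if (j : ℕ) + 1 = (i : ℕ) then ((j : ℕ) + 1 : ℚ) * (bigW G wG + 1) else 0) =
      (if (j : ℕ) + 1 = (i : ℕ) then (i : ℕ) * (bigW G wG + 1) else 0) +
      (if (i : ℕ) + 1 = (j : ℕ) then ((i : ℕ) + 1 : ℚ) * (bigW G wG + 1) else 0) := by
    intro j
    split_ifs with h1 h2 h2
    · omega
    · simp
    · rw [← h2]; push_cast; ring
    · simp
  rw [Finset.sum_congr rfl fun j _ => h j, Finset.sum_add_distrib]
  refine add_le_add ?_ ?_
  · rcases Nat.eq_zero_or_pos (i : ℕ) with h0 | h0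
    · simp [h0]
    · have hj : ∀ j : Fin (n + 1), (j : ℕ) + 1 = (i : ℕ) ↔ j = ⟨(i : ℕ) - 1, by omega⟩ := by
        intro j
        rw [Fin.ext_iff]
        dsimp only
        omega
      simp [hj]
  · split_ifs with hi
    · refine (Finset.sum_eq_zero fun j _ => if_neg ?_).le
      omega
    · have hj : ∀ j : Fin (n + 1), (i : ℕ) + 1 = (j : ℕ) ↔ j = ⟨(i : ℕ) + 1, by omega⟩ := by
        intro j
        rw [Fin.ext_iff]
        dsimp only
        omega
      simp [hj]

theorem sum_wPrime_pathAgent_castSucc_le (s : Bool) (i : Fin n) :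
    ∑ b, wPrime G wG (pathAgent s i.castSucc) b ≤
      (i : ℕ) * (bigW G wG + 1) + ((i : ℕ) + 1 : ℚ) * (bigW G wG + 1) + bigW G wG := by
  have h := sum_path_row_le G wG i.castSucc
  have hi : (i : ℕ) ≠ n := i.isLt.ne
  have hx : ∀ x : Fin n, (i : ℕ) = (x : ℕ) ↔ x = i := fun x => by rw [Fin.ext_iff, eq_comm]
  cases s <;>
    simp [Fintype.sum_sum_type, wPrime, pathAgent, hi, hx] at h ⊢ <;> linarith

theorem sum_wPrime_pathAgent_last_le :
    ∑ b, wPrime G wG (pathAgent true (Fin.last n)) b ≤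
      (n : ℚ) * (bigW G wG + 1) - 3 * ((n : ℚ) * bigW G wG + 1) := by
  have h := sum_path_row_le G wG (Fin.last n)
  have hx : ∀ x : Fin n, n ≠ (x : ℕ) := fun x => x.isLt.ne'
  have hj : ∀ j : Fin (n + 1), (j : ℕ) = n ↔ j = Fin.last n := fun j => by simp [Fin.ext_iff]
  simp [Fintype.sum_sum_type, wPrime, pathAgent, hx, hj] at h ⊢
  linarith

theorem sum_abs_wPrime_vertex (x : Fin n) :
    ∑ b, |wPrime G wG (Sum.inl x) b| =
      ∑ y, (if G.Adj x y then |(wG x y : ℚ)| else 0) + 2 * bigW G wG := by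
  have hW : |bigW G wG| = bigW G wG := abs_of_nonneg (by linarith [one_le_bigW G wG])
  have hj : ∀ j : Fin (n + 1), (j : ℕ) = (x : ℕ) ↔ j = x.castSucc := fun j => by
    simp [Fin.ext_iff]
  simp [Fintype.sum_sum_type, wPrime, hj, apply_ite abs, hW]
  ring

variable {G wG} {P : Fin n ⊕ (Fin (n + 1) ⊕ Fin (n + 1)) →
  Finset (Fin n ⊕ (Fin (n + 1) ⊕ Fin (n + 1)))}

theorem NashStable.sum_le (hP : IsPartitionFun P) (hNS : NashStable (wPrime G wG) P)
    (u : Fin n ⊕ (Fin (n + 1) ⊕ Fin (n + 1))) (C) (hC : C = ∅ ∨ ∃ v, C = P v) (hne : C ≠ P u) :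
    ∑ b ∈ C, wPrime G wG u b ≤ ∑ b ∈ P u, wPrime G wG u b := by
  have h := hNS u C hC hne
  rwa [util_eq_sum _ _ hP _ (wPrime_self G wG u)] at h

theorem NashStable.pathAgent_succ (hP : IsPartitionFun P) (hNS : NashStable (wPrime G wG) P)
    (s : Bool) (i : Fin n) : P (pathAgent s i.succ) = P (pathAgent s i.castSucc) := by
  by_contra hne
  have hle := hNS.sum_le hP _ _ (Or.inr ⟨_, rfl⟩) hne
  have hnn : ∀ b, 0 ≤ wPrime G wG (pathAgent s i.castSucc) b := fun b =>
    wPrime_pathAgent_nonneg G wG s _ b (Or.inl (Fin.castSucc_ne_last i))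
  have h1 := Finset.single_le_sum (fun b _ => hnn b) (hP.1 (pathAgent s i.succ))
  have h2 := sum_le_sum_univ_sub _ (pathAgent s i.succ) (fun b _ => hnn b)
    (P (pathAgent s i.castSucc)) (fun h => hne (hP.2 _ _ h))
  have h3 := sum_wPrime_pathAgent_castSucc_le G wG s i
  rw [wPrime_pathAgent_succ] at h1 h2
  linarith

theorem NashStable.pathAgent_eq (hP : IsPartitionFun P) (hNS : NashStable (wPrime G wG) P)
    (s : Bool) (i : Fin (n + 1)) : P (pathAgent s i) = P (pathAgent s 0) := by
  induction i using Fin.induction with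
  | zero => rfl
  | succ i ih => rw [hNS.pathAgent_succ hP, ih]

theorem NashStable.pathAgent_true_ne_false (hP : IsPartitionFun P)
    (hNS : NashStable (wPrime G wG) P) : P (pathAgent true 0) ≠ P (pathAgent false 0) := by
  intro heq
  have hmem : pathAgent false (Fin.last n) ∈ P (pathAgent true (Fin.last n)) := by
    rw [hNS.pathAgent_eq hP, heq, ← hNS.pathAgent_eq hP false (Fin.last n)]
    exact hP.1 _
  have hle := hNS.sum_le hP (pathAgent true (Fin.last n)) ∅ (Or.inl rfl)
    (Finset.ne_empty_of_mem hmem).symm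
  rw [Finset.sum_empty, ← Finset.add_sum_erase _ _ hmem] at hle
  have h1 := sum_le_sum_univ_sub (wPrime G wG (pathAgent true (Fin.last n)))
    (pathAgent false (Fin.last n))
    (fun b hb => wPrime_pathAgent_nonneg G wG true _ b (Or.inr hb))
    ((P (pathAgent true (Fin.last n))).erase (pathAgent false (Fin.last n)))
    (Finset.notMem_erase _ _)
  have h2 := sum_wPrime_pathAgent_last_le G wG
  have h3 : (n : ℚ) * 1 ≤ n * bigW G wG :=
    mul_le_mul_of_nonneg_left (one_le_bigW G wG) (Nat.cast_nonneg n)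
  linarith [(Nat.cast_nonneg n : (0 : ℚ) ≤ n)]

theorem NashStable.vertex_mem (hsymG : ∀ x y, wG x y = wG y x) (hP : IsPartitionFun P)
    (hNS : NashStable (wPrime G wG) P) (x : Fin n) :
    P (Sum.inl x) = P (pathAgent true 0) ∨ P (Sum.inl x) = P (pathAgent false 0) := by
  by_contra! hne
  have hside : ∀ s, P (Sum.inl x) ≠ P (pathAgent s 0) := by
    rintro (_ | _)
    exacts [hne.2, hne.1]
  set f := wPrime G wG (Sum.inl x) with hf
  set p : Bool → Fin n ⊕ (Fin (n + 1) ⊕ Fin (n + 1)) := fun s => pathAgent s x.castSucc with hp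
  have hPp : ∀ s, P (p s) = P (pathAgent s 0) := fun s => hNS.pathAgent_eq hP s _
  have hfp : ∀ s, f (p s) = bigW G wG := by
    rintro (_ | _) <;> simp [hf, hp, wPrime, pathAgent]
  have hle := hNS.sum_le hP (Sum.inl x) (P (p true)) (Or.inr ⟨_, rfl⟩)
    (by rw [hPp]; exact (hside true).symm)
  rw [← hf, ← Finset.add_sum_erase _ _ (hP.1 (p true)), hfp] at hle
  have hdisj : Disjoint ((P (p true)).erase (p true)) (P (Sum.inl x)) := by
    rw [Finset.disjoint_left]
    intro b hb hb'
    refine hside true ?_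
    rw [← hP.2 _ _ hb', ← hPp, hP.2 _ _ (Finset.mem_of_mem_erase hb)]
  have hsub : (P (p true)).erase (p true) ∪ P (Sum.inl x) ⊆
      (Finset.univ.erase (p true)).erase (p false) := by
    intro b hb
    simp only [Finset.mem_union, Finset.mem_erase, Finset.mem_univ, and_true] at hb ⊢
    constructor
    · rintro rfl
      rcases hb with hb | hb
      · apply hNS.pathAgent_true_ne_false hP
        rw [← hPp, ← hPp, hP.2 _ _ hb.2]
      · exact hside false (by rw [← hPp, hP.2 _ _ hb])
    · rintro rfl
      rcases hb with hb | hb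
      · exact hb.1 rfl
      · exact hside true (by rw [← hPp, hP.2 _ _ hb])
  have h1 := Finset.sum_le_sum_of_subset_of_nonneg (f := fun b => |f b|) hsub
    (fun b _ _ => abs_nonneg _)
  rw [Finset.sum_union hdisj] at h1
  have hpne : p false ∈ Finset.univ.erase (p true) := by
    simp [hp, pathAgent]
  have h2 := Finset.add_sum_erase _ (fun b => |f b|) hpne
  have h3 := Finset.add_sum_erase _ (fun b => |f b|) (Finset.mem_univ (p true))
  have hW := one_le_bigW G wG
  simp only [hfp, abs_of_nonneg (zero_le_one.trans hW)] at h2 h3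
  have h4 := sum_abs_wPrime_vertex G wG x
  rw [← hf] at h4
  have h5 := row_abs_le_bigW G wG hsymG x
  have h6 : ∑ b ∈ P (Sum.inl x), f b ≤ ∑ b ∈ P (Sum.inl x), |f b| :=
    Finset.sum_le_sum fun b _ => le_abs_self _
  have h7 : -∑ b ∈ (P (p true)).erase (p true), f b ≤
      ∑ b ∈ (P (p true)).erase (p true), |f b| := by
    rw [← Finset.sum_neg_distrib]
    exact Finset.sum_le_sum fun b _ => neg_le_abs _
  linarith

end Reduction

/-- every Nash-stable partition of the agents of `G′` consists of exactly two
coalitions `C_A` and `C_B` with `P_A ⊆ C_A`, `P_B ⊆ C_B` and `V ⊆ C_A ∪ C_B`; in particular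
it has the form `{C₁ ∪ P_A, C₂ ∪ P_B}` for some 2-partition `(C₁,C₂) = (S,Sᶜ)` of `V`. -/
theorem nash_stable_partition_form {n : ℕ} (hn : 1 ≤ n)
    (G : SimpleGraph (Fin n)) [DecidableRel G.Adj]
    (wG : Fin n → Fin n → ℤ) (hsymG : ∀ x y, wG x y = wG y x)
    (P : Fin n ⊕ (Fin (n + 1) ⊕ Fin (n + 1)) → Finset (Fin n ⊕ (Fin (n + 1) ⊕ Fin (n + 1))))
    (hP : IsPartitionFun P) (hNS : NashStable (wPrime G wG) P) :
    ∃ S : Finset (Fin n), ∀ a, P a = cutPart S a := by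
  have hAB := hNS.pathAgent_true_ne_false hP
  have hV := hNS.vertex_mem hsymG hP
  refine ⟨Finset.univ.filter fun x => P (Sum.inl x) = P (pathAgent true 0), fun a => ?_⟩
  let c : Fin n ⊕ (Fin (n + 1) ⊕ Fin (n + 1)) → Bool :=
    Sum.elim (fun x => decide (x ∈ Finset.univ.filter
      fun x => P (Sum.inl x) = P (pathAgent true 0)))
      (Sum.elim (fun _ => true) (fun _ => false))
  have hc : ∀ b, P b = P (pathAgent (c b) 0) := by
    rintro (x | i | i)
    · by_cases hx : P (Sum.inl x) = P (pathAgent true 0)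
      · simp [c, hx]
      · simpa [c, hx] using (hV x).resolve_left hx
    · exact hNS.pathAgent_eq hP true i
    · exact hNS.pathAgent_eq hP false i
  have hinj : ∀ s t, P (pathAgent s 0) = P (pathAgent t 0) → s = t := by
    rintro (_ | _) (_ | _) h
    exacts [rfl, (hAB h.symm).elim, (hAB h).elim, rfl]
  ext b
  have hmem : b ∈ P a ↔ P b = P a := ⟨hP.2 a b, fun h => h ▸ hP.1 b⟩
  have hcut : b ∈ P a ↔ c b = c a := by
    rw [hmem, hc b, hc a]
    exact ⟨hinj _ _, fun h => by rw [h]⟩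
  simpa [cutPart, classPart, c] using hcut
end
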